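/- For every integer N ≥ 1 there exists a constant C > 0 depending only on N with the following property: for every λ ∈ 𝔻 and every function f of the form f = (z−1)^N g + p with g ∈ H² and p a polynomial of degree < N, one has D₁^N(φ_λ f) ≤ D₁^N(f) + C·max{ |p^{(j)}(1)/j!|² : 0 ≤ j ≤ N−1 }·(1−|λ|²)/|1−λ|^{2N}. -/

import Mathlib

open Complex MeasureTheory Metric Set Finset Filter Polynomial
open scoped ENNReal NNReal Topology

noncomputable section

/-- Membership in the Hardy space `H²` of the unit disk. -/
def MemHardy2 (f : ℂ → ℂ) : Prop :=
  DifferentiableOn ℂ f (ball (0 : ℂ) 1) ∧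
  ∃ C : ℝ, ∀ r : ℝ, 0 < r → r < 1 →
    (1 / (2 * Real.pi)) * ∫ t in (0 : ℝ)..(2 * Real.pi),
      ‖f ((r : ℂ) * Complex.exp ((t : ℂ) * Complex.I))‖ ^ 2 ≤ C

/-- The squared `H²` norm of `f`, as the supremum of the circle means. -/
def h2NormSq (f : ℂ → ℂ) : ℝ :=
  sSup {y : ℝ | ∃ r : ℝ, 0 < r ∧ r < 1 ∧
    y = (1 / (2 * Real.pi)) * ∫ t in (0 : ℝ)..(2 * Real.pi),
      ‖f ((r : ℂ) * Complex.exp ((t : ℂ) * Complex.I))‖ ^ 2}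

/-- The local Dirichlet integral of order `N` at the point `1`:
`D₁^N(h) = inf { ‖(h-q)/(z-1)^N‖²_{H²} : q polynomial, deg q < N, (h-q)/(z-1)^N ∈ H² }`,
with value `∞` if no such `q` exists. -/
def D1N (N : ℕ) (h : ℂ → ℂ) : ℝ≥0∞ :=
  ⨅ (q : Polynomial ℂ) (_ : q.degree < (N : ℕ) ∧
      MemHardy2 fun z => (h z - q.eval z) / (z - 1) ^ N),
    ENNReal.ofReal (h2NormSq fun z => (h z - q.eval z) / (z - 1) ^ N)

lemma circleMean_eq_circleAverage (f : ℂ → ℂ) (r : ℝ) :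
    (1 / (2 * Real.pi)) * ∫ t in (0 : ℝ)..(2 * Real.pi),
      ‖f ((r : ℂ) * Complex.exp ((t : ℂ) * Complex.I))‖ ^ 2 =
      Real.circleAverage (fun z ↦ ‖f z‖ ^ 2) 0 r := by
  simp [Real.circleAverage, circleMap]

lemma sphere_zero_abs_subset_ball {r : ℝ} (h0 : 0 < r) (h1 : r < 1) :
    sphere (0 : ℂ) |r| ⊆ ball 0 1 := by
  rw [abs_of_pos h0]
  intro z hz
  simp_all

lemma circleAverage_norm_sq_polynomial (p : ℂ[X]) (r : ℝ) :
    Real.circleAverage (fun z ↦ ‖p.eval z‖ ^ 2) 0 r =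
      ∑ i ∈ range (p.natDegree + 1), ‖p.coeff i‖ ^ 2 * (r ^ 2) ^ i := by
  have h := (p.comp (C (r : ℂ) * X)).sum_sq_norm_coeff_eq_circleAverage
  rw [Real.circleAverage_eq_circleAverage_zero_one]
  simp only [eval_comp, eval_mul, eval_C, eval_X, comp_C_mul_X_coeff] at h
  simp only [add_zero]
  rw [← h]
  have hsub : (p.comp (C (r : ℂ) * X)).support ⊆ range (p.natDegree + 1) := by
    intro i hi
    rw [Polynomial.mem_support_iff, comp_C_mul_X_coeff] at hi
    rw [Finset.mem_range, Nat.lt_succ_iff]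
    exact le_natDegree_of_ne_zero (left_ne_zero_of_mul hi)
  rw [Finset.sum_subset hsub]
  · refine Finset.sum_congr rfl fun i _ ↦ ?_
    simp only [norm_mul, norm_pow, Complex.norm_real, Real.norm_eq_abs, mul_pow]
    rw [← pow_mul, mul_comm i 2, pow_mul, sq_abs]
  · intro i _ hi
    rw [Polynomial.notMem_support_iff, comp_C_mul_X_coeff] at hi
    simp [hi]

lemma circleAverage_norm_sq_polynomial_mono (p : ℂ[X]) {r s : ℝ} (hr : 0 ≤ r) (hrs : r ≤ s) :
    Real.circleAverage (fun z ↦ ‖p.eval z‖ ^ 2) 0 r ≤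
      Real.circleAverage (fun z ↦ ‖p.eval z‖ ^ 2) 0 s := by
  simp only [circleAverage_norm_sq_polynomial]
  gcongr

lemma exists_polynomial_tendsto_circleAverage {f : ℂ → ℂ}
    (hf : DifferentiableOn ℂ f (ball 0 1)) :
    ∃ P : ℕ → ℂ[X], ∀ r : ℝ, 0 ≤ r → r < 1 →
      Tendsto (fun n ↦ Real.circleAverage (fun z ↦ ‖(P n).eval z‖ ^ 2) 0 r) atTop
        (𝓝 (Real.circleAverage (fun z ↦ ‖f z‖ ^ 2) 0 r)) := by
  obtain ⟨a, ha⟩ : ∃ a : ℕ → ℂ, ∀ z ∈ ball (0 : ℂ) 1, HasSum (fun n ↦ a n * z ^ n) (f z) := by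
    refine ⟨fun n ↦ (n.factorial : ℂ)⁻¹ * iteratedDeriv n f 0, fun z hz ↦ ?_⟩
    convert! Complex.hasSum_taylorSeries_on_ball hf hz using 2 with n
    simp only [smul_eq_mul, sub_zero]
    ring
  refine ⟨fun n ↦ ∑ i ∈ range n, C (a i) * X ^ i, fun r h0 h1 ↦ ?_⟩
  have hr : (r : ℂ) ∈ ball (0 : ℂ) 1 := by simpa [abs_of_nonneg h0] using h1
  have hs : Summable fun n ↦ ‖a n‖ * r ^ n := by
    simpa [abs_of_nonneg h0] using (ha _ hr).summable.norm
  refine Tendsto.const_smul ?_ _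
  refine intervalIntegral.tendsto_integral_filter_of_dominated_convergence
    (fun _ ↦ (∑' n, ‖a n‖ * r ^ n) ^ 2) ?_ ?_ intervalIntegrable_const ?_
  · refine Eventually.of_forall fun n ↦ Continuous.aestronglyMeasurable ?_
    have := continuous_circleMap 0 r
    have := (∑ i ∈ range n, C (a i) * X ^ i).continuous
    fun_prop
  · refine Eventually.of_forall fun n ↦ Eventually.of_forall fun t _ ↦ ?_
    rw [Real.norm_of_nonneg (by positivity)]
    refine pow_le_pow_left₀ (norm_nonneg _) ?_ 2
    rw [eval_finsetSum]
    refine (norm_sum_le _ _).trans ?_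
    simp only [eval_mul, eval_C, eval_pow, eval_X, norm_mul, norm_pow, norm_circleMap_zero,
      abs_of_nonneg h0]
    exact hs.sum_le_tsum _ fun i _ ↦ by positivity
  · refine Eventually.of_forall fun t _ ↦ ?_
    have hz : circleMap 0 r t ∈ ball (0 : ℂ) 1 := by simpa [abs_of_nonneg h0] using h1
    have := (ha _ hz).tendsto_sum_nat
    simp only [eval_finsetSum, eval_mul, eval_C, eval_pow, eval_X]
    exact (this.norm).pow 2

lemma circleAverage_norm_sq_mono {f : ℂ → ℂ} (hf : DifferentiableOn ℂ f (ball 0 1)) {r s : ℝ}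
    (hr : 0 ≤ r) (hrs : r ≤ s) (hs : s < 1) :
    Real.circleAverage (fun z ↦ ‖f z‖ ^ 2) 0 r ≤ Real.circleAverage (fun z ↦ ‖f z‖ ^ 2) 0 s := by
  obtain ⟨P, hP⟩ := exists_polynomial_tendsto_circleAverage hf
  exact le_of_tendsto_of_tendsto' (hP r hr (hrs.trans_lt hs)) (hP s (hr.trans hrs) hs)
    fun n ↦ circleAverage_norm_sq_polynomial_mono (P n) hr hrs

lemma circleIntegrable_of_continuousOn_ball {E : Type*} [NormedAddCommGroup E] {f : ℂ → E}
    {r : ℝ} (hf : ContinuousOn f (ball 0 1)) (h0 : 0 < r) (h1 : r < 1) :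
    CircleIntegrable f 0 r :=
  (hf.mono (sphere_zero_abs_subset_ball h0 h1)).circleIntegrable'

lemma diffContOnCl_ball_of_lt_one {f : ℂ → ℂ} (hf : DifferentiableOn ℂ f (ball 0 1)) {r : ℝ}
    (h0 : 0 < r) (h1 : r < 1) : DiffContOnCl ℂ f (ball 0 |r|) := by
  rw [abs_of_pos h0]
  exact (hf.mono (closure_ball_subset_closedBall.trans
    (closedBall_subset_ball h1))).diffContOnCl

lemma norm_circleAverage_le_circleAverage_norm (f : ℂ → ℂ) (c : ℂ) (R : ℝ) :
    ‖Real.circleAverage f c R‖ ≤ Real.circleAverage (fun z ↦ ‖f z‖) c R := by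
  rw [Real.circleAverage, Real.circleAverage, norm_smul, smul_eq_mul,
    Real.norm_of_nonneg (by positivity)]
  gcongr
  exact intervalIntegral.norm_integral_le_integral_norm (by positivity)

lemma MemHardy2.exists_circleAverage_le {f : ℂ → ℂ} (hf : MemHardy2 f) :
    ∃ C : ℝ, ∀ r : ℝ, 0 < r → r < 1 → Real.circleAverage (fun z ↦ ‖f z‖ ^ 2) 0 r ≤ C := by
  simpa only [circleMean_eq_circleAverage] using hf.2

lemma MemHardy2.circleAverage_le_h2NormSq {f : ℂ → ℂ} (hf : MemHardy2 f) {r : ℝ}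
    (h0 : 0 < r) (h1 : r < 1) :
    Real.circleAverage (fun z ↦ ‖f z‖ ^ 2) 0 r ≤ h2NormSq f := by
  obtain ⟨C, hC⟩ := hf.2
  refine le_csSup ⟨C, ?_⟩ ⟨r, h0, h1, (circleMean_eq_circleAverage f r).symm⟩
  rintro y ⟨s, hs0, hs1, rfl⟩
  exact hC s hs0 hs1

lemma h2NormSq_le {f : ℂ → ℂ} {C : ℝ}
    (hC : ∀ r : ℝ, 0 < r → r < 1 → Real.circleAverage (fun z ↦ ‖f z‖ ^ 2) 0 r ≤ C) :
    h2NormSq f ≤ C := by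
  refine csSup_le ⟨_, 1 / 2, by norm_num, by norm_num, rfl⟩ ?_
  rintro y ⟨s, hs0, hs1, rfl⟩
  rw [circleMean_eq_circleAverage]
  exact hC s hs0 hs1

lemma memHardy2_of_circleAverage_le {f : ℂ → ℂ} {C : ℝ} (hf : DifferentiableOn ℂ f (ball 0 1))
    (hC : ∀ r : ℝ, 0 < r → r < 1 → Real.circleAverage (fun z ↦ ‖f z‖ ^ 2) 0 r ≤ C) :
    MemHardy2 f :=
  ⟨hf, C, by simpa only [circleMean_eq_circleAverage] using hC⟩

lemma circleAverage_norm_sq_congr {f g : ℂ → ℂ} (hfg : EqOn f g (ball 0 1)) {r : ℝ}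
    (h0 : 0 < r) (h1 : r < 1) :
    Real.circleAverage (fun z ↦ ‖f z‖ ^ 2) 0 r = Real.circleAverage (fun z ↦ ‖g z‖ ^ 2) 0 r :=
  Real.circleAverage_congr_sphere fun z hz ↦ by
    simp only [hfg (sphere_zero_abs_subset_ball h0 h1 hz)]

lemma h2NormSq_congr {f g : ℂ → ℂ} (hfg : EqOn f g (ball 0 1)) : h2NormSq f = h2NormSq g := by
  unfold h2NormSq
  congr 1
  ext y
  refine exists_congr fun r ↦ and_congr_right fun h0 ↦ and_congr_right fun h1 ↦ ?_
  rw [circleMean_eq_circleAverage, circleMean_eq_circleAverage,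
    circleAverage_norm_sq_congr hfg h0 h1]

lemma MemHardy2.exists_norm_sq_mul_one_sub_le {f : ℂ → ℂ} (hf : MemHardy2 f) :
    ∃ C : ℝ, ∀ x : ℝ, 0 < x → x < 1 → ‖f x‖ ^ 2 * (1 - x) ≤ C := by
  obtain ⟨C, hC⟩ := hf.exists_circleAverage_le
  have hcont := hf.1.continuousOn
  refine ⟨C, fun x hx0 hx1 ↦ ?_⟩
  have key : ∀ r ∈ Ioo x 1, ‖f x‖ ^ 2 * (r - x) ≤ C := by
    rintro r ⟨hxr, hr1⟩
    have hr0 : 0 < r := hx0.trans hxr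
    have hw : (x : ℂ) ∈ ball (0 : ℂ) |r| := by
      simpa [abs_of_pos hx0, abs_of_pos hr0] using hxr
    have h1 := (diffContOnCl_ball_of_lt_one (hf.1.pow 2) hr0 hr1).circleAverage_smul_div hw
    have hne : ∀ z ∈ sphere (0 : ℂ) |r|, r - x ≤ ‖z - x‖ := by
      intro z hz
      have hz' : ‖z‖ = r := by simpa [abs_of_pos hr0] using hz
      have := norm_sub_norm_le z (x : ℂ)
      rwa [hz', Complex.norm_real, Real.norm_of_nonneg hx0.le] at this
    have hne' : ∀ z ∈ sphere (0 : ℂ) |r|, z - x ≠ 0 := fun z hz ↦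
      norm_pos_iff.1 ((sub_pos.2 hxr).trans_le (hne z hz))
    have h2 : ‖f x‖ ^ 2 ≤ (r - x)⁻¹ * C := by
      calc ‖f x‖ ^ 2 = ‖f x ^ 2‖ := (norm_pow _ _).symm
        _ ≤ Real.circleAverage (fun z ↦ ‖((z - 0) / (z - x)) • f z ^ 2‖) 0 r := by
            rw [← Pi.pow_apply, ← h1]
            exact norm_circleAverage_le_circleAverage_norm _ _ _
        _ ≤ Real.circleAverage (fun z ↦ (r - x)⁻¹ • ‖f z‖ ^ 2) 0 r := by
            refine Real.circleAverage_mono ?_ ?_ ?_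
            · refine ContinuousOn.circleIntegrable' ?_
              have := hcont.mono (sphere_zero_abs_subset_ball hr0 hr1)
              refine ContinuousOn.norm (ContinuousOn.smul (ContinuousOn.div ?_ ?_ hne') ?_)
              all_goals fun_prop
            · exact circleIntegrable_of_continuousOn_ball (by fun_prop) hr0 hr1
            · intro z hz
              have hz' : ‖z‖ = r := by simpa [abs_of_pos hr0] using hz
              rw [norm_smul, norm_div, sub_zero, norm_pow, hz', smul_eq_mul, div_eq_mul_inv]
              have := hne z hz
              have := sub_pos.2 hxr
              gcongr
              calc r * ‖z - x‖⁻¹ ≤ 1 * (r - x)⁻¹ := by gcongr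
                _ = _ := one_mul _
        _ = (r - x)⁻¹ * Real.circleAverage (fun z ↦ ‖f z‖ ^ 2) 0 r := by
            rw [Real.circleAverage_fun_smul, smul_eq_mul]
        _ ≤ _ := by
            have := sub_pos.2 hxr
            gcongr
            exact hC r hr0 hr1
    rwa [inv_mul_eq_div, le_div_iff₀ (sub_pos.2 hxr)] at h2
  have hlim : Tendsto (fun r : ℝ ↦ ‖f x‖ ^ 2 * (r - x)) (𝓝[<] 1) (𝓝 (‖f x‖ ^ 2 * (1 - x))) :=
    (Continuous.tendsto (by fun_prop) 1).mono_left nhdsWithin_le_nhds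
  exact le_of_tendsto hlim (eventually_of_mem (Ioo_mem_nhdsLT hx1) key)

lemma eq_of_memHardy2_sub_div {N : ℕ} {f : ℂ → ℂ} {p q : ℂ[X]} (hp : p.degree < N)
    (hq : q.degree < N) (hfp : MemHardy2 fun z ↦ (f z - p.eval z) / (z - 1) ^ N)
    (hfq : MemHardy2 fun z ↦ (f z - q.eval z) / (z - 1) ^ N) : q = p := by
  by_contra hne
  obtain ⟨A, hA⟩ := hfp.exists_norm_sq_mul_one_sub_le
  obtain ⟨B, hB⟩ := hfq.exists_norm_sq_mul_one_sub_le
  have hd : p - q ≠ 0 := sub_ne_zero.2 (Ne.symm hne)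
  obtain ⟨s, hs, hs1⟩ := Polynomial.exists_eq_pow_rootMultiplicity_mul_and_not_dvd (p - q) hd 1
  set k := (p - q).rootMultiplicity 1
  have hk : k < N := by
    have h1 : (p - q).natDegree < N := by
      rw [natDegree_lt_iff_degree_lt hd]
      exact (degree_sub_le _ _).trans_lt (max_lt hp hq)
    have h2 := (Multiset.count_le_card (1 : ℂ) (p - q).roots).trans (card_roots' _)
    rw [count_roots] at h2
    exact h2.trans_lt h1
  have key : ∀ x ∈ Ioo (0 : ℝ) 1, ‖s.eval (x : ℂ)‖ ^ 2 ≤ (2 * A + 2 * B) * (1 - x) := by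
    rintro x ⟨hx0, hx1⟩
    have hx : 0 < 1 - x := sub_pos.2 hx1
    have h1 := hA x hx0 hx1
    have h2 := hB x hx0 hx1
    have hnx : ‖(x : ℂ) - 1‖ = 1 - x := by
      rw [← Complex.ofReal_one, ← Complex.ofReal_sub, Complex.norm_real, Real.norm_eq_abs,
        abs_sub_comm, abs_of_pos hx]
    have hx' : (x : ℂ) - 1 ≠ 0 := norm_pos_iff.1 (hnx ▸ hx)
    have h3 : s.eval (x : ℂ) = ((x : ℂ) - 1) ^ (N - k) *
        ((f x - q.eval (x : ℂ)) / ((x : ℂ) - 1) ^ N -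
          (f x - p.eval (x : ℂ)) / ((x : ℂ) - 1) ^ N) := by
      have h4 : p.eval (x : ℂ) - q.eval (x : ℂ) = ((x : ℂ) - 1) ^ k * s.eval (x : ℂ) := by
        rw [← eval_sub, hs]
        simp
      rw [← sub_div, sub_sub_sub_cancel_left, h4, ← Nat.sub_add_cancel hk.le, pow_add]
      simp only [Nat.add_sub_cancel]
      field_simp
    set u := (f x - q.eval (x : ℂ)) / ((x : ℂ) - 1) ^ N
    set v := (f x - p.eval (x : ℂ)) / ((x : ℂ) - 1) ^ N
    have h5 : ‖u - v‖ ^ 2 ≤ 2 * ‖u‖ ^ 2 + 2 * ‖v‖ ^ 2 := by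
      have := norm_sub_le u v
      nlinarith [sq_nonneg (‖u‖ - ‖v‖), norm_nonneg (u - v)]
    have h6 : ‖((x : ℂ) - 1) ^ (N - k)‖ ≤ 1 - x := by
      rw [norm_pow, hnx]
      exact pow_le_of_le_one hx.le (by linarith) (by omega)
    calc ‖s.eval (x : ℂ)‖ ^ 2 = ‖((x : ℂ) - 1) ^ (N - k)‖ ^ 2 * ‖u - v‖ ^ 2 := by
          rw [h3, norm_mul, mul_pow]
      _ ≤ (1 - x) ^ 2 * (2 * ‖u‖ ^ 2 + 2 * ‖v‖ ^ 2) := by gcongr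
      _ = (1 - x) * (2 * (‖u‖ ^ 2 * (1 - x)) + 2 * (‖v‖ ^ 2 * (1 - x))) := by ring
      _ ≤ (1 - x) * (2 * B + 2 * A) := by gcongr
      _ = _ := by ring
  have hL : Tendsto (fun x : ℝ ↦ ‖s.eval (x : ℂ)‖ ^ 2) (𝓝[<] 1) (𝓝 (‖s.eval (1 : ℂ)‖ ^ 2)) := by
    have hc : Continuous fun x : ℝ ↦ ‖s.eval (x : ℂ)‖ ^ 2 := by
      have := s.continuous
      fun_prop
    simpa using (hc.tendsto 1).mono_left nhdsWithin_le_nhds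
  have hR : Tendsto (fun x : ℝ ↦ (2 * A + 2 * B) * (1 - x)) (𝓝[<] 1) (𝓝 0) := by
    have hc : Continuous fun x : ℝ ↦ (2 * A + 2 * B) * (1 - x) := by fun_prop
    simpa using (hc.tendsto 1).mono_left nhdsWithin_le_nhds
  have h0 := le_of_tendsto_of_tendsto hL hR (eventually_of_mem (Ioo_mem_nhdsLT one_pos) key)
  refine hs1 (dvd_iff_isRoot.2 ?_)
  have : ‖s.eval (1 : ℂ)‖ = 0 := by nlinarith [norm_nonneg (s.eval (1 : ℂ))]
  exact norm_eq_zero.1 this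

lemma one_sub_conj_mul_ne_zero {lam z : ℂ} (hl : ‖lam‖ < 1) (hz : ‖z‖ < 1) :
    1 - (starRingEnd ℂ) lam * z ≠ 0 := by
  intro h
  have h1 : ‖(starRingEnd ℂ) lam * z‖ = 1 := by rw [← sub_eq_zero.1 h, norm_one]
  rw [norm_mul, Complex.norm_conj] at h1
  nlinarith [norm_nonneg lam, norm_nonneg z]

lemma norm_blaschke_le_one {lam z : ℂ} (hl : ‖lam‖ < 1) (hz : ‖z‖ < 1) :
    ‖(z - lam) / (1 - (starRingEnd ℂ) lam * z)‖ ≤ 1 := by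
  rw [norm_div]
  refine div_le_one_of_le₀ ?_ (norm_nonneg _)
  refine (sq_le_sq₀ (norm_nonneg _) (norm_nonneg _)).1 ?_
  have h : ‖1 - (starRingEnd ℂ) lam * z‖ ^ 2 - ‖z - lam‖ ^ 2 =
      (1 - ‖lam‖ ^ 2) * (1 - ‖z‖ ^ 2) := by
    simp only [← Complex.normSq_eq_norm_sq, Complex.normSq_apply, Complex.sub_re, Complex.sub_im,
      Complex.mul_re, Complex.mul_im, Complex.conj_re, Complex.conj_im, Complex.one_re,
      Complex.one_im]
    ring
  have h1 : 0 ≤ 1 - ‖lam‖ ^ 2 := by nlinarith [norm_nonneg lam]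
  have h2 : 0 ≤ 1 - ‖z‖ ^ 2 := by nlinarith [norm_nonneg z]
  nlinarith [mul_nonneg h1 h2]

/-- Reproducing property of the Szegő kernel on the circle of radius `r`. -/
lemma circleAverage_mul_conj_szego {f : ℂ → ℂ} (hf : DifferentiableOn ℂ f (ball 0 1)) {lam : ℂ}
    (hl : ‖lam‖ < 1) {r : ℝ} (h0 : 0 < r) (h1 : r < 1) :
    Real.circleAverage
      (fun z ↦ f z * (starRingEnd ℂ) (1 / (1 - (starRingEnd ℂ) lam * z))) 0 r =
      f ((r : ℂ) ^ 2 * lam) := by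
  have hw : (r : ℂ) ^ 2 * lam ∈ ball (0 : ℂ) |r| := by
    rw [mem_ball_zero_iff, norm_mul, norm_pow, Complex.norm_real, Real.norm_eq_abs,
      abs_of_pos h0]
    nlinarith [norm_nonneg lam, mul_pos h0 h0]
  rw [← (diffContOnCl_ball_of_lt_one hf h0 h1).circleAverage_smul_div hw]
  refine Real.circleAverage_congr_sphere fun z hz ↦ ?_
  have hz' : ‖z‖ = r := by simpa [abs_of_pos h0] using hz
  have hz0 : z ≠ 0 := norm_pos_iff.1 (hz' ▸ h0)
  have hzz : z * (starRingEnd ℂ) z = (r : ℂ) ^ 2 := by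
    rw [Complex.mul_conj, Complex.normSq_eq_norm_sq, hz', Complex.ofReal_pow]
  have hfac : z - (r : ℂ) ^ 2 * lam = z * (1 - lam * (starRingEnd ℂ) z) := by
    rw [← hzz]
    ring
  simp only [map_div₀, map_one, map_sub, map_mul, Complex.conj_conj, sub_zero, smul_eq_mul]
  rw [hfac, div_mul_cancel_left₀ hz0, one_div, mul_comm]

lemma norm_sq_add_mul (u k c : ℂ) : ‖u + c * k‖ ^ 2 =
    ‖u‖ ^ 2 + (‖c‖ ^ 2 * (k * (starRingEnd ℂ) k).re +
      ((starRingEnd ℂ) c * (u * (starRingEnd ℂ) k)).re * 2) := by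
  simp only [← Complex.normSq_eq_norm_sq, Complex.normSq_apply, Complex.add_re, Complex.add_im,
    Complex.mul_re, Complex.mul_im, Complex.conj_re, Complex.conj_im]
  ring

lemma circleAverage_re {f : ℂ → ℂ} {r : ℝ} (hf : CircleIntegrable f 0 r) :
    Real.circleAverage (fun z ↦ (f z).re) 0 r = (Real.circleAverage f 0 r).re :=
  Complex.reCLM.circleAverage_comp_comm hf

lemma circleAverage_norm_sq_blaschke_mul_add_szego_le {g : ℂ → ℂ} (hg : MemHardy2 g) {lam : ℂ}
    (hl : ‖lam‖ < 1) (c : ℂ) {r : ℝ} (h0 : 0 < r) (h1 : r < 1) :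
    Real.circleAverage (fun z ↦ ‖(z - lam) / (1 - (starRingEnd ℂ) lam * z) * g z +
      c * (1 / (1 - (starRingEnd ℂ) lam * z))‖ ^ 2) 0 r ≤
      h2NormSq g + ‖c‖ ^ 2 / (1 - ‖lam‖ ^ 2) := by
  set k : ℂ → ℂ := fun z ↦ 1 / (1 - (starRingEnd ℂ) lam * z) with hk
  set u : ℂ → ℂ := fun z ↦ (z - lam) / (1 - (starRingEnd ℂ) lam * z) * g z with hu
  have hden : ∀ z ∈ ball (0 : ℂ) 1, 1 - (starRingEnd ℂ) lam * z ≠ 0 := fun z hz ↦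
    one_sub_conj_mul_ne_zero hl (by simpa using hz)
  have hkd : DifferentiableOn ℂ k (ball 0 1) :=
    DifferentiableOn.div (by fun_prop) (by fun_prop) hden
  have hud : DifferentiableOn ℂ u (ball 0 1) :=
    (DifferentiableOn.div (by fun_prop) (by fun_prop) hden).mul hg.1
  have hl2 : 0 < 1 - ‖lam‖ ^ 2 := by nlinarith [norm_nonneg lam]
  have key : ∀ s ∈ Ioo r 1, Real.circleAverage (fun z ↦ ‖u z + c * k z‖ ^ 2) 0 r ≤
      h2NormSq g + ‖c‖ ^ 2 / (1 - ‖lam‖ ^ 2) +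
        ((starRingEnd ℂ) c * u ((s : ℂ) ^ 2 * lam)).re * 2 := by
    rintro s ⟨hrs, hs1⟩
    have hs0 : 0 < s := h0.trans hrs
    have hkc := hkd.continuousOn
    have huc := hud.continuousOn
    have hgc := hg.1.continuousOn
    have hkk : ContinuousOn (fun z ↦ k z * (starRingEnd ℂ) (k z)) (ball 0 1) :=
      hkc.mul (Complex.continuous_conj.comp_continuousOn hkc)
    have huk : ContinuousOn (fun z ↦ u z * (starRingEnd ℂ) (k z)) (ball 0 1) :=
      huc.mul (Complex.continuous_conj.comp_continuousOn hkc)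
    have hck : ContinuousOn (fun z ↦ (starRingEnd ℂ) c * (u z * (starRingEnd ℂ) (k z)))
      (ball 0 1) := continuousOn_const.mul huk
    have hckr := Complex.continuous_re.comp_continuousOn hck
    have hkkr := Complex.continuous_re.comp_continuousOn hkk
    refine (circleAverage_norm_sq_mono (hud.add (hkd.const_mul c)) h0.le hrs.le hs1).trans ?_
    have e1 : Real.circleAverage (fun z ↦ ‖u z‖ ^ 2) 0 s ≤ h2NormSq g := by
      refine le_trans (Real.circleAverage_mono ?_ ?_ ?_) (hg.circleAverage_le_h2NormSq hs0 hs1)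
      · exact circleIntegrable_of_continuousOn_ball (by fun_prop) hs0 hs1
      · exact circleIntegrable_of_continuousOn_ball (by fun_prop) hs0 hs1
      · intro z hz
        have hz1 : ‖z‖ < 1 := by simpa using sphere_zero_abs_subset_ball hs0 hs1 hz
        rw [hu, norm_mul, mul_pow]
        exact mul_le_of_le_one_left (by positivity)
          (pow_le_one₀ (norm_nonneg _) (norm_blaschke_le_one hl hz1))
    have e2 : Real.circleAverage (fun z ↦ (k z * (starRingEnd ℂ) (k z)).re) 0 s ≤
        1 / (1 - ‖lam‖ ^ 2) := by
      rw [circleAverage_re (circleIntegrable_of_continuousOn_ball hkk hs0 hs1),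
        circleAverage_mul_conj_szego hkd hl hs0 hs1]
      have e3 : k ((s : ℂ) ^ 2 * lam) = ((1 / (1 - s ^ 2 * ‖lam‖ ^ 2) : ℝ) : ℂ) := by
        have : (starRingEnd ℂ) lam * ((s : ℂ) ^ 2 * lam) = (s : ℂ) ^ 2 * (‖lam‖ : ℂ) ^ 2 := by
          rw [← Complex.conj_mul' lam]
          ring
        simp only [hk, this]
        push_cast
        rfl
      rw [e3, Complex.ofReal_re]
      gcongr
      exact mul_le_of_le_one_left (by positivity) (pow_le_one₀ hs0.le hs1.le)
    have e4 : Real.circleAverage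
        (fun z ↦ ((starRingEnd ℂ) c * (u z * (starRingEnd ℂ) (k z))).re) 0 s =
        ((starRingEnd ℂ) c * u ((s : ℂ) ^ 2 * lam)).re := by
      rw [circleAverage_re (circleIntegrable_of_continuousOn_ball hck hs0 hs1),
        ← circleAverage_mul_conj_szego hud hl hs0 hs1]
      congr 1
      exact Real.circleAverage_fun_smul (a := (starRingEnd ℂ) c)
    have i1 : CircleIntegrable (fun z ↦ ‖u z‖ ^ 2) 0 s :=
      circleIntegrable_of_continuousOn_ball (by fun_prop) hs0 hs1
    have i2 : CircleIntegrable (fun z ↦ ‖c‖ ^ 2 * (k z * (starRingEnd ℂ) (k z)).re) 0 s :=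
      circleIntegrable_of_continuousOn_ball (continuousOn_const.mul hkkr) hs0 hs1
    have i3 : CircleIntegrable
        (fun z ↦ ((starRingEnd ℂ) c * (u z * (starRingEnd ℂ) (k z))).re * 2) 0 s :=
      circleIntegrable_of_continuousOn_ball (hckr.mul continuousOn_const) hs0 hs1
    have i23 : CircleIntegrable (fun z ↦ ‖c‖ ^ 2 * (k z * (starRingEnd ℂ) (k z)).re +
        ((starRingEnd ℂ) c * (u z * (starRingEnd ℂ) (k z))).re * 2) 0 s := i2.add i3
    have e5 : Real.circleAverage (fun z ↦ ‖c‖ ^ 2 * (k z * (starRingEnd ℂ) (k z)).re) 0 s =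
        ‖c‖ ^ 2 * Real.circleAverage (fun z ↦ (k z * (starRingEnd ℂ) (k z)).re) 0 s :=
      Real.circleAverage_fun_smul (a := ‖c‖ ^ 2)
    have e6 : Real.circleAverage
        (fun z ↦ ((starRingEnd ℂ) c * (u z * (starRingEnd ℂ) (k z))).re * 2) 0 s =
        2 * Real.circleAverage
          (fun z ↦ ((starRingEnd ℂ) c * (u z * (starRingEnd ℂ) (k z))).re) 0 s := by
      simp only [mul_comm _ (2 : ℝ)]
      exact Real.circleAverage_fun_smul (a := (2 : ℝ))
    calc Real.circleAverage (fun z ↦ ‖u z + c * k z‖ ^ 2) 0 s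
        = Real.circleAverage (fun z ↦ ‖u z‖ ^ 2) 0 s +
          (‖c‖ ^ 2 * Real.circleAverage (fun z ↦ (k z * (starRingEnd ℂ) (k z)).re) 0 s +
          2 * ((starRingEnd ℂ) c * u ((s : ℂ) ^ 2 * lam)).re) := by
          simp only [norm_sq_add_mul]
          rw [Real.circleAverage_fun_add i1 i23, Real.circleAverage_fun_add i2 i3, e5, e6,
            e4]
      _ ≤ h2NormSq g + (‖c‖ ^ 2 * (1 / (1 - ‖lam‖ ^ 2)) +
          2 * ((starRingEnd ℂ) c * u ((s : ℂ) ^ 2 * lam)).re) := by gcongr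
      _ = _ := by ring
  have hlim : Tendsto (fun s : ℝ ↦ h2NormSq g + ‖c‖ ^ 2 / (1 - ‖lam‖ ^ 2) +
      ((starRingEnd ℂ) c * u ((s : ℂ) ^ 2 * lam)).re * 2) (𝓝[<] 1)
      (𝓝 (h2NormSq g + ‖c‖ ^ 2 / (1 - ‖lam‖ ^ 2) +
        ((starRingEnd ℂ) c * u lam).re * 2)) := by
    have hlm : lam ∈ ball (0 : ℂ) 1 := by simpa using hl
    have hcu : ContinuousAt u lam :=
      hud.continuousOn.continuousAt (isOpen_ball.mem_nhds hlm)
    have hmap : Tendsto (fun s : ℝ ↦ (s : ℂ) ^ 2 * lam) (𝓝[<] 1) (𝓝 lam) := by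
      have hc : Continuous fun s : ℝ ↦ (s : ℂ) ^ 2 * lam := by fun_prop
      simpa using (hc.tendsto 1).mono_left nhdsWithin_le_nhds
    exact (((Complex.continuous_re.tendsto _).comp
      ((hcu.tendsto.comp hmap).const_mul _)).mul_const 2).const_add _
  have hul : u lam = 0 := by simp [hu]
  rw [hul, mul_zero, Complex.zero_re, zero_mul, add_zero] at hlim
  exact ge_of_tendsto hlim (eventually_of_mem (Ioo_mem_nhdsLT h1) key)

lemma exists_pow_eq_mul_add_pow (N : ℕ) (a b : ℂ) (ha : a ≠ 0) (m : ℕ) (hm : m ≤ N) :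
    ∃ s ∈ degreeLT ℂ N, (X - 1 : ℂ[X]) ^ (N - m) =
      (C a - C b * (X - 1)) * s + C ((b / a) ^ m) * (X - 1) ^ N := by
  induction m with
  | zero => exact ⟨0, zero_mem _, by simp⟩
  | succ m ih =>
    obtain ⟨s, hs, h⟩ := ih (by omega)
    refine ⟨a⁻¹ • (X - 1) ^ (N - (m + 1)) + (b / a) • s, ?_, ?_⟩
    · refine add_mem (Submodule.smul_mem _ _ ?_) (Submodule.smul_mem _ _ hs)
      rw [mem_degreeLT, ← C_1, degree_pow, degree_X_sub_C]
      simp only [nsmul_eq_mul, mul_one]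
      exact_mod_cast (by omega : N - (m + 1) < N)
    · rw [show N - m = N - (m + 1) + 1 by omega, pow_succ] at h
      have h1 : (C a * C a⁻¹ : ℂ[X]) = 1 := by rw [← C_mul, mul_inv_cancel₀ ha, C_1]
      simp only [smul_eq_C_mul, pow_succ (b * a⁻¹) m, C_mul, div_eq_mul_inv] at h ⊢
      linear_combination (C b * C a⁻¹) * h - (X - 1) ^ (N - (m + 1)) * h1

lemma eq_sum_taylor_one_coeff_mul_pow {N : ℕ} {p : ℂ[X]} (hp : p.degree < N) :
    p = ∑ j ∈ range N, C ((taylor 1 p).coeff j) * (X - 1) ^ j := by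
  conv_lhs => rw [← sum_taylor_eq p 1, Polynomial.sum_def, C_1]
  refine Finset.sum_subset (fun j hj ↦ ?_) fun j _ hj ↦ ?_
  · rw [Finset.mem_range]
    have := (le_degree_of_mem_supp j hj).trans_lt ((degree_taylor p 1).trans_lt hp)
    exact_mod_cast this
  · rw [Polynomial.notMem_support_iff.1 hj, C_0, zero_mul]

lemma taylor_one_coeff_eq (p : ℂ[X]) (j : ℕ) :
    (taylor 1 p).coeff j = (derivative^[j] p).eval 1 / (j.factorial : ℂ) := by
  rw [taylor_coeff, ← factorial_smul_hasseDeriv,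
    eq_div_iff (Nat.cast_ne_zero.2 j.factorial_ne_zero)]
  simp [mul_comm]

lemma exists_blaschke_numerator_mul_eq {N : ℕ} {p : ℂ[X]} (hp : p.degree < N) {lam : ℂ}
    (ha : 1 - (starRingEnd ℂ) lam ≠ 0) :
    ∃ q : ℂ[X], q.degree < N ∧ (X - C lam) * p =
      (1 - C ((starRingEnd ℂ) lam) * X) * q +
        C (∑ j ∈ range N, (taylor 1 p).coeff j * ((1 - ‖lam‖ ^ 2) / (1 - (starRingEnd ℂ) lam) *
          ((starRingEnd ℂ) lam / (1 - (starRingEnd ℂ) lam)) ^ (N - 1 - j))) * (X - 1) ^ N := by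
  set b := (starRingEnd ℂ) lam with hb
  set a := 1 - b with hab
  have key : ∀ j ∈ range N, ∃ s ∈ degreeLT ℂ N, (X - C lam) * (X - 1) ^ j =
      (1 - C b * X) * s + C ((1 - ‖lam‖ ^ 2) / a * (b / a) ^ (N - 1 - j)) * (X - 1) ^ N := by
    intro j hj
    rw [Finset.mem_range] at hj
    obtain ⟨s, hs, h⟩ := exists_pow_eq_mul_add_pow N a b ha (N - 1 - j) (by omega)
    rw [show N - (N - 1 - j) = j + 1 by omega] at h
    refine ⟨((1 - lam) / a) • (X - 1) ^ j + ((1 - ‖lam‖ ^ 2) / a) • s, ?_, ?_⟩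
    · refine add_mem (Submodule.smul_mem _ _ ?_) (Submodule.smul_mem _ _ hs)
      rw [mem_degreeLT, ← C_1, degree_pow, degree_X_sub_C]
      simp only [nsmul_eq_mul, mul_one]
      exact_mod_cast hj
    · have h1 : (C a * C a⁻¹ : ℂ[X]) = 1 := by rw [← C_mul, mul_inv_cancel₀ ha, C_1]
      have h2 : (C a : ℂ[X]) = 1 - C b := by rw [hab, C_sub, C_1]
      have h3 : (C (1 - (‖lam‖ : ℂ) ^ 2) : ℂ[X]) = 1 - C b * C lam := by
        rw [← Complex.conj_mul', C_sub, C_mul, C_1]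
      simp only [smul_eq_C_mul, C_mul, div_eq_mul_inv, h3, C_sub (a := (1 : ℂ)), C_1] at h ⊢
      rw [h2] at h1 h
      linear_combination (1 - C b * C lam) * C a⁻¹ * h - (X - C lam) * (X - 1) ^ j * h1
  choose! s hs h using key
  refine ⟨∑ j ∈ range N, (taylor 1 p).coeff j • s j, ?_, ?_⟩
  · rw [← mem_degreeLT]
    exact sum_mem fun j hj ↦ Submodule.smul_mem _ _ (hs j hj)
  · conv_lhs => rw [eq_sum_taylor_one_coeff_mul_pow hp]
    rw [map_sum, Finset.mul_sum, Finset.mul_sum, Finset.sum_mul, ← Finset.sum_add_distrib]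
    refine Finset.sum_congr rfl fun j hj ↦ ?_
    rw [smul_eq_C_mul, C_mul]
    linear_combination C ((taylor 1 p).coeff j) * h j hj

lemma norm_sq_sum_div_le {N : ℕ} (hN : (range N).Nonempty) (t : ℕ → ℂ) {lam : ℂ}
    (hl : ‖lam‖ < 1) :
    ‖∑ j ∈ range N, t j * ((1 - ‖lam‖ ^ 2) / (1 - (starRingEnd ℂ) lam) *
      ((starRingEnd ℂ) lam / (1 - (starRingEnd ℂ) lam)) ^ (N - 1 - j))‖ ^ 2 / (1 - ‖lam‖ ^ 2) ≤
    (N * 2 ^ N) ^ 2 * (range N).sup' hN (fun j ↦ ‖t j‖ ^ 2) *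
      ((1 - ‖lam‖ ^ 2) / ‖1 - lam‖ ^ (2 * N)) := by
  set M := (range N).sup' hN (fun j ↦ ‖t j‖ ^ 2) with hM
  have hl2 : 0 < 1 - ‖lam‖ ^ 2 := by nlinarith [norm_nonneg lam]
  have hna : ‖1 - (starRingEnd ℂ) lam‖ = ‖1 - lam‖ := by
    rw [← Complex.norm_conj]
    simp
  have hap : 0 < ‖1 - lam‖ := by
    have := norm_sub_norm_le (1 : ℂ) lam
    rw [norm_one] at this
    linarith
  have ha2 : ‖1 - lam‖ ≤ 2 := by
    have := norm_sub_le (1 : ℂ) lam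
    rw [norm_one] at this
    linarith
  have htM : ∀ j ∈ range N, ‖t j‖ ≤ √M := fun j hj ↦
    Real.le_sqrt_of_sq_le (Finset.le_sup' (fun j ↦ ‖t j‖ ^ 2) hj)
  have hM0 : 0 ≤ M := by
    obtain ⟨j, hj⟩ := hN
    exact (sq_nonneg ‖t j‖).trans (Finset.le_sup' (fun j ↦ ‖t j‖ ^ 2) hj)
  have hterm : ∀ j ∈ range N, ‖t j * ((1 - ‖lam‖ ^ 2) / (1 - (starRingEnd ℂ) lam) *
      ((starRingEnd ℂ) lam / (1 - (starRingEnd ℂ) lam)) ^ (N - 1 - j))‖ ≤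
      √M * ((1 - ‖lam‖ ^ 2) * (2 ^ N / ‖1 - lam‖ ^ N)) := by
    intro j hj
    have hjN := Finset.mem_range.1 hj
    have h1 : ‖(1 : ℂ) - (‖lam‖ : ℂ) ^ 2‖ = 1 - ‖lam‖ ^ 2 := by
      rw [← Complex.ofReal_pow, ← Complex.ofReal_one, ← Complex.ofReal_sub, Complex.norm_real,
        Real.norm_of_nonneg hl2.le]
    rw [norm_mul, norm_mul, norm_pow, norm_div, norm_div, hna, h1, Complex.norm_conj,
      div_eq_mul_inv (1 - ‖lam‖ ^ 2), mul_assoc (1 - ‖lam‖ ^ 2)]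
    have h2 : ‖1 - lam‖⁻¹ * (‖lam‖ / ‖1 - lam‖) ^ (N - 1 - j) ≤ 2 ^ N / ‖1 - lam‖ ^ N := by
      have h3 : ‖1 - lam‖ ^ N = ‖1 - lam‖ * ‖1 - lam‖ ^ (N - 1 - j) * ‖1 - lam‖ ^ j := by
        rw [← pow_succ', ← pow_add]
        congr 1
        omega
      rw [le_div_iff₀ (by positivity), h3, div_pow]
      calc _ = ‖lam‖ ^ (N - 1 - j) * ‖1 - lam‖ ^ j := by field_simp
        _ ≤ 1 * 2 ^ j := by
          gcongr
          exact pow_le_one₀ (norm_nonneg _) hl.le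
        _ ≤ 2 ^ N := by
          rw [one_mul]
          exact pow_le_pow_right₀ one_le_two hjN.le
    have := htM j hj
    gcongr
  have hsum := norm_sum_le_of_le _ hterm
  rw [Finset.sum_const, Finset.card_range, nsmul_eq_mul] at hsum
  rw [div_le_iff₀ hl2]
  refine (pow_le_pow_left₀ (norm_nonneg _) hsum 2).trans (le_of_eq ?_)
  simp only [mul_pow, div_pow, Real.sq_sqrt hM0, ← pow_mul, mul_comm 2 N]
  field_simp

/-- **Lemma.** For every `N ≥ 1` there is `C > 0` depending only on `N` such that for every
`λ ∈ 𝔻` and every `f = (z-1)^N g + p` with `g ∈ H²` and `p` a polynomial of degree `< N`: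
`D₁^N(φ_λ f) ≤ D₁^N(f) + C · max_{0 ≤ j < N} |p^{(j)}(1)/j!|² · (1-|λ|²)/|1-λ|^{2N}`. -/
theorem statement7 (N : ℕ) (hN : 1 ≤ N) :
    ∃ C : ℝ, 0 < C ∧
      ∀ (lam : ℂ), ‖lam‖ < 1 →
        ∀ (f g : ℂ → ℂ) (p : Polynomial ℂ), MemHardy2 g → p.degree < (N : ℕ) →
          (∀ z ∈ ball (0 : ℂ) 1, f z = (z - 1) ^ N * g z + p.eval z) →
          D1N N (fun z => (z - lam) / (1 - (starRingEnd ℂ) lam * z) * f z) ≤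
            D1N N f + ENNReal.ofReal (C *
              ((range N).sup' (nonempty_range_iff.mpr (by omega))
                fun j => ‖((Polynomial.derivative (R := ℂ))^[j] p).eval 1 /
                  (j.factorial : ℂ)‖ ^ 2) *
              ((1 - ‖lam‖ ^ 2) / ‖1 - lam‖ ^ (2 * N))) := by
  refine ⟨(N * 2 ^ N) ^ 2, by positivity, fun lam hl f g p hg hp hf ↦ ?_⟩
  have hz1 : ∀ z ∈ ball (0 : ℂ) 1, (z - 1) ^ N ≠ 0 := by
    intro z hz
    refine pow_ne_zero _ (sub_ne_zero.2 ?_)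
    rintro rfl
    simp at hz
  have hfp : EqOn (fun z ↦ (f z - p.eval z) / (z - 1) ^ N) g (ball 0 1) := by
    intro z hz
    have := hz1 z hz
    simp only [hf z hz]
    field_simp
    ring
  have hfpH : MemHardy2 fun z ↦ (f z - p.eval z) / (z - 1) ^ N := by
    obtain ⟨B, hB⟩ := hg.exists_circleAverage_le
    refine memHardy2_of_circleAverage_le (hg.1.congr hfp) (C := B) fun r h0 h1 ↦ ?_
    rw [circleAverage_norm_sq_congr hfp h0 h1]
    exact hB r h0 h1
  have hlow : ENNReal.ofReal (h2NormSq g) ≤ D1N N f := by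
    refine le_iInf₂ fun q hq ↦ ?_
    obtain rfl := eq_of_memHardy2_sub_div hp hq.1 hfpH hq.2
    rw [h2NormSq_congr hfp]
  have ha : 1 - (starRingEnd ℂ) lam ≠ 0 := by
    refine sub_ne_zero.2 fun h ↦ hl.ne ?_
    rw [← Complex.norm_conj, ← h, norm_one]
  obtain ⟨q, hq, hpq⟩ := exists_blaschke_numerator_mul_eq hp ha
  have hbd := norm_sq_sum_div_le (N := N) (nonempty_range_iff.mpr (by omega)) (taylor 1 p).coeff hl
  simp only [taylor_one_coeff_eq] at hpq hbd
  set c := ∑ j ∈ range N, (derivative^[j] p).eval 1 / (j.factorial : ℂ) *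
    ((1 - ‖lam‖ ^ 2) / (1 - (starRingEnd ℂ) lam) *
    ((starRingEnd ℂ) lam / (1 - (starRingEnd ℂ) lam)) ^ (N - 1 - j))
  have hF : EqOn (fun z ↦ ((z - lam) / (1 - (starRingEnd ℂ) lam * z) * f z - q.eval z) /
      (z - 1) ^ N) (fun z ↦ (z - lam) / (1 - (starRingEnd ℂ) lam * z) * g z +
      c * (1 / (1 - (starRingEnd ℂ) lam * z))) (ball 0 1) := by
    intro z hz
    have h1 := hz1 z hz
    have h2 := one_sub_conj_mul_ne_zero hl (by simpa using hz : ‖z‖ < 1)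
    have h3 := congrArg (eval z) hpq
    simp only [eval_mul, eval_sub, eval_add, eval_X, eval_C, eval_pow, eval_one] at h3
    simp only [hf z hz]
    rw [div_eq_iff h1]
    set d := 1 - (starRingEnd ℂ) lam * z
    field_simp
    linear_combination h3
  have hb : ∀ r : ℝ, 0 < r → r < 1 → Real.circleAverage (fun z ↦
      ‖((z - lam) / (1 - (starRingEnd ℂ) lam * z) * f z - q.eval z) / (z - 1) ^ N‖ ^ 2) 0 r ≤
      h2NormSq g + ‖c‖ ^ 2 / (1 - ‖lam‖ ^ 2) := by
    intro r h0 h1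
    rw [circleAverage_norm_sq_congr hF h0 h1]
    exact circleAverage_norm_sq_blaschke_mul_add_szego_le hg hl c h0 h1
  have hd : DifferentiableOn ℂ (fun z ↦ (z - lam) / (1 - (starRingEnd ℂ) lam * z) * g z +
      c * (1 / (1 - (starRingEnd ℂ) lam * z))) (ball 0 1) := by
    have hden : ∀ z ∈ ball (0 : ℂ) 1, 1 - (starRingEnd ℂ) lam * z ≠ 0 := fun z hz ↦
      one_sub_conj_mul_ne_zero hl (by simpa using hz)
    exact ((DifferentiableOn.div (by fun_prop) (by fun_prop) hden).mul hg.1).add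
      ((DifferentiableOn.div (by fun_prop) (by fun_prop) hden).const_mul c)
  calc D1N N (fun z => (z - lam) / (1 - (starRingEnd ℂ) lam * z) * f z)
      ≤ ENNReal.ofReal (h2NormSq fun z ↦
          ((z - lam) / (1 - (starRingEnd ℂ) lam * z) * f z - q.eval z) / (z - 1) ^ N) :=
        iInf₂_le q ⟨hq, memHardy2_of_circleAverage_le (hd.congr hF) hb⟩
    _ ≤ ENNReal.ofReal (h2NormSq g + ‖c‖ ^ 2 / (1 - ‖lam‖ ^ 2)) :=
        ENNReal.ofReal_le_ofReal (h2NormSq_le hb)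
    _ ≤ ENNReal.ofReal (h2NormSq g) + ENNReal.ofReal (‖c‖ ^ 2 / (1 - ‖lam‖ ^ 2)) :=
        ENNReal.ofReal_add_le
    _ ≤ _ := add_le_add hlow (ENNReal.ofReal_le_ofReal hbd)
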